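/- arXiv:2307.01034 — 2 statements merged into one kernel-verified Lean document; each statement's English description precedes it below -/
import Mathlib

section
/- Let −c̄ ∈ cone{a_t : t ∈ T}. Then Hof F_c̄^op = max_{b ∈ dom F} Lipusc F^op(c̄,b) = max_{b ∈ dom F} max_{x ∈ E^op(c̄,b)} clm F^op((c̄,b),x) = max over all pairs D ⊆ S ⊆ T with D ∈ M_c̄ of ( d_*(0_n, end conv{a_t, t ∈ S; −a_t, t ∈ D}) )^{-1}. In particular all these suprema/maxima are attained and equal. -/
open scoped ENNReal RealInnerProductSpace
open Filter EMetric Set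

/-- Calmness modulus of a set-valued mapping `M` at `(ybar, xbar)`:
`limsup_{x → xbar} d(x, M(ybar)) / d(ybar, M⁻¹(x))`, with conventions `0/0 = 0`
and `d(·, ∅) = ∞` (automatic in `ℝ≥0∞`). -/
noncomputable def clmMod {Y X : Type*} [PseudoEMetricSpace Y] [PseudoEMetricSpace X]
    (M : Y → Set X) (ybar : Y) (xbar : X) : ℝ≥0∞ :=
  Filter.limsup
    (fun x => EMetric.infEdist x (M ybar) / EMetric.infEdist ybar {y | x ∈ M y}) (nhds xbar)

/-- Lipschitz upper semicontinuity modulus of `M` at `ybar`: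
`limsup_{y → ybar} sup_{x ∈ M(y)} d(x, M(ybar)) / d(y, ybar)`. -/
noncomputable def lipuscMod {Y X : Type*} [PseudoEMetricSpace Y] [PseudoEMetricSpace X]
    (M : Y → Set X) (ybar : Y) : ℝ≥0∞ :=
  Filter.limsup
    (fun y => ⨆ x ∈ M y, EMetric.infEdist x (M ybar) / edist y ybar) (nhds ybar)

/-- Hoffman constant of `M`: `sup_{(y,x) ∈ dom M × X} d(x, M(y)) / d(y, M⁻¹(x))`. -/
noncomputable def hofConst {Y X : Type*} [PseudoEMetricSpace Y] [PseudoEMetricSpace X]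
    (M : Y → Set X) : ℝ≥0∞ :=
  ⨆ y ∈ {y | (M y).Nonempty}, ⨆ x : X,
    EMetric.infEdist x (M y) / EMetric.infEdist y {y' | x ∈ M y'}

/-- The feasible set mapping `F(b) = {x ∈ ℝⁿ : ⟨a_t, x⟩ ≤ b_t for all t ∈ T}`. -/
def Feas {n m : ℕ} (a : Fin m → EuclideanSpace ℝ (Fin n)) (b : Fin m → ℝ) :
    Set (EuclideanSpace ℝ (Fin n)) :=
  {x | ∀ t, ⟪a t, x⟫ ≤ b t}

/-- The optimal set (argmin) mapping `F^op(c,b) = argmin{⟨c,x⟩ : x ∈ F(b)}`. -/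
def Fop {n m : ℕ} (a : Fin m → EuclideanSpace ℝ (Fin n)) (c : EuclideanSpace ℝ (Fin n))
    (b : Fin m → ℝ) : Set (EuclideanSpace ℝ (Fin n)) :=
  {x | x ∈ Feas a b ∧ ∀ y ∈ Feas a b, ⟪c, x⟫ ≤ ⟪c, y⟫}

/-- Active index set `T_b(x) = {t ∈ T : ⟨a_t, x⟩ = b_t}`. -/
def activeSet {n m : ℕ} (a : Fin m → EuclideanSpace ℝ (Fin n)) (b : Fin m → ℝ)
    (x : EuclideanSpace ℝ (Fin n)) : Set (Fin m) :=
  {t | ⟪a t, x⟫ = b t}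

/-- `z ∈ cone{a_t : t ∈ D}` (conical convex hull). -/
def InCone {n m : ℕ} (a : Fin m → EuclideanSpace ℝ (Fin n)) (D : Finset (Fin m))
    (z : EuclideanSpace ℝ (Fin n)) : Prop :=
  ∃ lam : Fin m → ℝ, (∀ t, 0 ≤ lam t) ∧ (∀ t ∉ D, lam t = 0) ∧ z = ∑ t, lam t • a t

/-- The family of minimal KKT index subsets `M_{c,b}`: all `D ⊆ T_b(x)` (for an optimal
point `x ∈ F^op(c,b)`; independent of the choice of `x`) with `−c ∈ cone{a_t : t ∈ D}`,
minimal with respect to inclusion among such subsets. (It is empty when `F^op(c,b) = ∅`.) -/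
def Mcb {n m : ℕ} (a : Fin m → EuclideanSpace ℝ (Fin n)) (c : EuclideanSpace ℝ (Fin n))
    (b : Fin m → ℝ) : Set (Finset (Fin m)) :=
  {D | ∃ x ∈ Fop a c b, (D : Set (Fin m)) ⊆ activeSet a b x ∧ InCone a D (-c) ∧
    ∀ D' ⊆ D, InCone a D' (-c) → D' = D}

/-- `M_c = {D ⊆ T : −c ∈ cone{a_t : t ∈ D} and D minimal w.r.t. inclusion}`. -/
def Mc {n m : ℕ} (a : Fin m → EuclideanSpace ℝ (Fin n)) (c : EuclideanSpace ℝ (Fin n)) :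
    Set (Finset (Fin m)) :=
  {D | InCone a D (-c) ∧ ∀ D' ⊆ D, InCone a D' (-c) → D' = D}

/-- `E^op(c,b) = extr(F^op(c,b) ∩ span{a_t : t ∈ T})`. -/
def Eop {n m : ℕ} (a : Fin m → EuclideanSpace ℝ (Fin n)) (c : EuclideanSpace ℝ (Fin n))
    (b : Fin m → ℝ) : Set (EuclideanSpace ℝ (Fin n)) :=
  Set.extremePoints ℝ
    (Fop a c b ∩ (Submodule.span ℝ (Set.range a) : Set (EuclideanSpace ℝ (Fin n))))

/-- End set of a convex set `C`: `end C = {u ∈ cl C : ¬∃ μ > 1, μ • u ∈ cl C}`. -/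
def endSet {E : Type*} [NormedAddCommGroup E] [NormedSpace ℝ E] (C : Set E) : Set E :=
  {u ∈ closure C | ¬ ∃ μ : ℝ, 1 < μ ∧ μ • u ∈ closure C}


/-- The conical hull of the vectors `v i`, `i ∈ s`. -/
def finCone {ι E : Type*} [Fintype ι] [AddCommGroup E] [Module ℝ E] (v : ι → E) (s : Finset ι) :
    Set E :=
  {z | ∃ lam : ι → ℝ, (∀ i, 0 ≤ lam i) ∧ (∀ i ∉ s, lam i = 0) ∧ z = ∑ i, lam i • v i}

section FinCone

variable {ι E : Type*} [Fintype ι]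

section Module

variable [AddCommGroup E] [Module ℝ E] {v : ι → E} {s t : Finset ι} {z : E}

theorem finCone_mono (h : s ⊆ t) : finCone v s ⊆ finCone v t := by
  rintro z ⟨lam, h0, hs, rfl⟩
  exact ⟨lam, h0, fun i hi => hs i fun his => hi (h his), rfl⟩

theorem zero_mem_finCone : (0 : E) ∈ finCone v s :=
  ⟨0, fun _ => le_rfl, fun _ _ => rfl, by simp⟩

theorem smul_mem_finCone {r : ℝ} (hr : 0 ≤ r) (hz : z ∈ finCone v s) : r • z ∈ finCone v s := by
  obtain ⟨lam, h0, hs, rfl⟩ := hz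
  refine ⟨fun i => r * lam i, fun i => mul_nonneg hr (h0 i), fun i hi => by simp [hs i hi], ?_⟩
  simp [Finset.smul_sum, mul_smul]

theorem mem_finCone_of_mem {i : ι} (hi : i ∈ s) : v i ∈ finCone v s := by
  classical
  refine ⟨Pi.single i 1, fun j => ?_, fun j hj => ?_, ?_⟩
  · by_cases h : j = i
    · subst h; simp
    · simp [h]
  · have : j ≠ i := fun h => hj (h ▸ hi)
    simp [this]
  · simp [Pi.single_apply, ite_smul]

theorem convex_finCone : Convex ℝ (finCone v s) := by
  rintro x ⟨lam, h0, hs, rfl⟩ y ⟨mu, k0, ks, rfl⟩ p q hp hq -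
  refine ⟨fun i => p * lam i + q * mu i, fun i => ?_, fun i hi => by simp [hs i hi, ks i hi], ?_⟩
  · exact add_nonneg (mul_nonneg hp (h0 i)) (mul_nonneg hq (k0 i))
  · simp [Finset.smul_sum, mul_smul, add_smul, Finset.sum_add_distrib]

/-- Carathéodory's theorem for conical hulls. -/
theorem exists_linearIndepOn_mem_finCone (hz : z ∈ finCone v s) :
    ∃ t ⊆ s, LinearIndepOn ℝ v (t : Set ι) ∧ z ∈ finCone v t := by
  classical
  induction s using Finset.strongInduction with
  | H s ih =>
  by_cases hli : LinearIndepOn ℝ v (s : Set ι)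
  · exact ⟨s, subset_rfl, hli, hz⟩
  obtain ⟨lam, h0, hs, rfl⟩ := hz
  obtain ⟨g, hg, hgpos⟩ : ∃ g : ι → ℝ, ∑ i ∈ s, g i • v i = 0 ∧ ∃ i ∈ s, 0 < g i := by
    rw [linearIndepOn_finset_iff] at hli
    push Not at hli
    obtain ⟨g, hg, i, hi, hgi⟩ := hli
    rcases lt_or_gt_of_ne hgi with h | h
    · exact ⟨fun i => -g i, by simp [hg], i, hi, by simpa using h⟩
    · exact ⟨g, hg, i, hi, h⟩
  obtain ⟨i₁, hi₁, hgi₁⟩ := hgpos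
  obtain ⟨i₀, hi₀, hmin⟩ := Finset.exists_min_image (s.filter fun i => 0 < g i)
    (fun i => lam i / g i) ⟨i₁, by simp [hi₁, hgi₁]⟩
  simp only [Finset.mem_filter] at hi₀ hmin
  set r := lam i₀ / g i₀ with hr
  have hr0 : 0 ≤ r := div_nonneg (h0 _) hi₀.2.le
  obtain ⟨t, hts, ht⟩ := ih (s.erase i₀) (Finset.erase_ssubset hi₀.1) (by
    refine ⟨fun i => if i ∈ s then lam i - r * g i else 0, fun i => ?_, fun i hi => ?_, ?_⟩
    · dsimp only
      split_ifs with his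
      · rcases le_or_gt (g i) 0 with h | h
        · nlinarith [h0 i]
        · have := hmin i ⟨his, h⟩
          rw [le_div_iff₀ h] at this
          linarith
      · exact le_rfl
    · dsimp only
      split_ifs with his
      · have : i = i₀ := by
          by_contra hne
          exact hi (Finset.mem_erase.2 ⟨hne, his⟩)
        rw [this, hr, div_mul_cancel₀ _ hi₀.2.ne', sub_self]
      · rfl
    · have h1 : ∑ i, lam i • v i = ∑ i ∈ s, lam i • v i :=
        (Finset.sum_subset (Finset.subset_univ _) fun i _ hi => by simp [hs i hi]).symm
      simp only [ite_smul, zero_smul]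
      rw [h1, Finset.sum_ite_mem, Finset.univ_inter]
      simp [sub_smul, mul_smul, ← Finset.smul_sum, hg])
  exact ⟨t, hts.trans (Finset.erase_subset _ _), ht⟩

end Module

section Normed

variable [NormedAddCommGroup E] [NormedSpace ℝ E] {v : ι → E} {s : Finset ι}

theorem isClosed_finCone_of_linearIndepOn (hli : LinearIndepOn ℝ v (s : Set ι)) :
    IsClosed (finCone v s) := by
  classical
  let f : (s → ℝ) →ₗ[ℝ] E := Fintype.linearCombination ℝ (fun i : s => v i)
  have hf : Topology.IsClosedEmbedding f :=
    LinearMap.isClosedEmbedding_of_injective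
      (LinearMap.ker_eq_bot.2 (LinearIndependent.fintypeLinearCombination_injective hli))
  have himg : finCone v s = f '' {lam | ∀ i, 0 ≤ lam i} := by
    ext z
    constructor
    · rintro ⟨lam, h0, hs, rfl⟩
      refine ⟨fun i => lam i, fun i => h0 i, ?_⟩
      simp only [f, Fintype.linearCombination_apply]
      rw [Finset.sum_coe_sort s (fun i => lam i • v i)]
      exact Finset.sum_subset (Finset.subset_univ _) fun i _ hi => by simp [hs i hi]
    · rintro ⟨mu, h0, rfl⟩
      refine ⟨fun i => if h : i ∈ s then mu ⟨i, h⟩ else 0, fun i => ?_, fun i hi => by simp [hi], ?_⟩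
      · dsimp only
        split_ifs with h
        · exact h0 _
        · exact le_rfl
      · simp only [f, Fintype.linearCombination_apply, dite_smul, zero_smul]
        rw [← Finset.sum_subset (Finset.subset_univ s) (fun i _ hi => by simp [hi]),
          ← Finset.sum_coe_sort s]
        simp
  rw [himg]
  refine hf.isClosedMap _ ?_
  simp only [setOf_forall]
  exact isClosed_iInter fun i => isClosed_le continuous_const (continuous_apply i)

theorem isClosed_finCone (v : ι → E) (s : Finset ι) : IsClosed (finCone v s) := by
  classical
  have h : finCone v s =
      ⋃ t ∈ {t : Finset ι | t ⊆ s ∧ LinearIndepOn ℝ v (t : Set ι)}, finCone v t := by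
    ext z
    simp only [mem_iUnion, mem_setOf_eq, exists_prop]
    constructor
    · intro hz
      obtain ⟨t, h1, h2, h3⟩ := exists_linearIndepOn_mem_finCone hz
      exact ⟨t, ⟨h1, h2⟩, h3⟩
    · rintro ⟨t, ⟨h1, -⟩, h3⟩
      exact finCone_mono h1 h3
  rw [h]
  exact (Set.toFinite _).isClosed_biUnion fun t ht => isClosed_finCone_of_linearIndepOn ht.2

/-- The sum of a finite-dimensional subspace (the range of `f`) and a finitely generated cone
is closed. -/
theorem isClosed_range_add_finCone {V : Type*} [AddCommGroup V] [Module ℝ V]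
    [FiniteDimensional ℝ V] (f : V →ₗ[ℝ] E) (v : ι → E) (s : Finset ι) :
    IsClosed {z | ∃ x, z - f x ∈ finCone v s} := by
  classical
  let B := Module.finBasis ℝ V
  let κ := Fin (Module.finrank ℝ V)
  let w : (κ ⊕ κ) ⊕ ι → E :=
    Sum.elim (Sum.elim (fun j => f (B j)) (fun j => -f (B j))) v
  let S : Finset ((κ ⊕ κ) ⊕ ι) := Finset.univ.disjSum s
  convert isClosed_finCone w S using 1
  ext z
  constructor
  · rintro ⟨x, lam, h0, hs, hz⟩
    refine ⟨Sum.elim (Sum.elim (fun j => max (B.repr x j) 0) (fun j => max (-B.repr x j) 0)) lam,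
      ?_, ?_, ?_⟩
    · rintro ((j | j) | i) <;> simp [h0]
    · rintro ((j | j) | i) hi
      · simp [S] at hi
      · simp [S] at hi
      · simpa using hs i (by simpa [S] using hi)
    · have hx : f x = ∑ j, B.repr x j • f (B j) := by
        conv_lhs => rw [← B.sum_repr x, map_sum]
        simp only [map_smul]
      rw [sub_eq_iff_eq_add] at hz
      rw [hz, hx]
      simp only [w, Fintype.sum_sum_type, Sum.elim_inl, Sum.elim_inr]
      rw [add_comm, ← Finset.sum_add_distrib]
      congr 1
      refine Finset.sum_congr rfl fun j _ => ?_
      rw [smul_neg, ← sub_eq_add_neg, ← sub_smul]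
      congr 1
      rcases le_total (B.repr x j) 0 with h | h <;> simp [h]
  · rintro ⟨lam, h0, hs, hz⟩
    refine ⟨∑ j, (lam (.inl (.inl j)) - lam (.inl (.inr j))) • B j, fun i => lam (.inr i),
      fun i => h0 _, fun i hi => hs _ (by simpa [S] using hi), ?_⟩
    rw [hz]
    simp [w, Fintype.sum_sum_type, sub_smul, Finset.sum_sub_distrib]
    abel

end Normed

section Inner

variable [NormedAddCommGroup E] [InnerProductSpace ℝ E] [CompleteSpace E]

/-- **Farkas' lemma** for finitely generated cones. -/
theorem exists_inner_pos_of_notMem_finCone {v : ι → E} {s : Finset ι} {z : E}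
    (hz : z ∉ finCone v s) : ∃ d : E, (∀ i ∈ s, ⟪v i, d⟫ ≤ 0) ∧ 0 < ⟪z, d⟫ := by
  obtain ⟨f, u, hfu, huz⟩ :=
    geometric_hahn_banach_closed_point (convex_finCone (v := v) (s := s)) (isClosed_finCone v s) hz
  have hu : 0 < u := by simpa using hfu 0 zero_mem_finCone
  refine ⟨(InnerProductSpace.toDual ℝ E).symm f, fun i hi => ?_, ?_⟩
  · rw [real_inner_comm, InnerProductSpace.toDual_symm_apply]
    by_contra! hpos
    have h := hfu ((u / f (v i)) • v i)
      (smul_mem_finCone (div_nonneg hu.le hpos.le) (mem_finCone_of_mem hi))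
    rw [map_smul, smul_eq_mul, div_mul_cancel₀ _ hpos.ne'] at h
    exact lt_irrefl _ h
  · rw [real_inner_comm, InnerProductSpace.toDual_symm_apply]
    exact hu.trans huz

/-- First-order optimality conditions for a linear functional on a polyhedron: if `⟪z, ·⟫` is
maximal over `{y | ∀ i ∈ A, ⟪v i, y⟫ ≤ β i}` at `x`, then `z` is a conical combination of the
active constraints. -/
theorem mem_finCone_of_isMax {v : ι → E} {β : ι → ℝ} {x z : E} {A s : Finset ι}
    (hx : ∀ i ∈ A, ⟪v i, x⟫ ≤ β i)
    (hmax : ∀ y, (∀ i ∈ A, ⟪v i, y⟫ ≤ β i) → ⟪z, y⟫ ≤ ⟪z, x⟫)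
    (hs : ∀ i ∈ A, ⟪v i, x⟫ = β i → i ∈ s) : z ∈ finCone v s := by
  by_contra hz
  obtain ⟨d, hd, hzd⟩ := exists_inner_pos_of_notMem_finCone hz
  have hev : ∀ᶠ r : ℝ in nhdsWithin 0 (Ioi 0), ∀ i ∈ A, ⟪v i, x + r • d⟫ ≤ β i := by
    rw [Filter.eventually_all_finset]
    intro i hi
    rcases (hx i hi).eq_or_lt with h | h
    · filter_upwards [self_mem_nhdsWithin] with r hr
      rw [inner_add_right, inner_smul_right, h]
      nlinarith [hd i (hs i hi h), mem_Ioi.1 hr]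
    · have hcont : Continuous fun r : ℝ => ⟪v i, x + r • d⟫ := by fun_prop
      have h0 : ⟪v i, x + (0 : ℝ) • d⟫ < β i := by simpa using h
      exact nhdsWithin_le_nhds
        ((hcont.continuousAt.eventually_lt continuousAt_const h0).mono fun r hr => hr.le)
  obtain ⟨r, hr, hr0⟩ := (hev.and self_mem_nhdsWithin).exists
  have h := hmax _ hr
  rw [inner_add_right, inner_smul_right] at h
  have := mul_pos (mem_Ioi.1 hr0) hzd
  linarith

end Inner

end FinCone

section EndSet

variable {ι E : Type*} [NormedAddCommGroup E]

theorem mem_endSet_convexHull_image [NormedSpace ℝ E] {w : ι → E} {s : Finset ι} {u : E} :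
    u ∈ endSet (convexHull ℝ (w '' s)) ↔
      u ∈ convexHull ℝ (w '' s) ∧ ∀ μ : ℝ, 1 < μ → μ • u ∉ convexHull ℝ (w '' s) := by
  have hcl : closure (convexHull ℝ (w '' s)) = convexHull ℝ (w '' s) :=
    ((s.finite_toSet.image w).isClosed_convexHull ℝ).closure_eq
  simp [endSet, hcl]

theorem inv_sum_smul_mem_convexHull [NormedSpace ℝ E] [Fintype ι] {w : ι → E} {s : Finset ι}
    {lam : ι → ℝ} (h0 : ∀ i, 0 ≤ lam i) (hs : ∀ i ∉ s, lam i = 0) (hpos : 0 < ∑ i, lam i) :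
    (∑ i, lam i)⁻¹ • ∑ i, lam i • w i ∈ convexHull ℝ (w '' s) := by
  have h1 : ∑ i, lam i = ∑ i ∈ s, lam i :=
    (Finset.sum_subset (Finset.subset_univ _) fun i _ hi => hs i hi).symm
  have h2 : ∑ i, lam i • w i = ∑ i ∈ s, lam i • w i :=
    (Finset.sum_subset (Finset.subset_univ _) fun i _ hi => by simp [hs i hi]).symm
  rw [h1] at hpos ⊢
  rw [h2]
  exact Finset.centerMass_mem_convexHull s (fun i _ => h0 i) hpos
    fun i hi => mem_image_of_mem w hi

theorem exists_pos_smul_mem_endSet [NormedSpace ℝ E] [Fintype ι] {w : ι → E} {s : Finset ι}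
    {v : E} (hv : v ∈ finCone w s) (hv0 : v ≠ 0) :
    ∃ τ : ℝ, 0 < τ ∧ τ • v ∈ endSet (convexHull ℝ (w '' s)) := by
  have hC : IsCompact (convexHull ℝ (w '' s)) := (s.finite_toSet.image w).isCompact_convexHull ℝ
  obtain ⟨lam, h0, hs, hvl⟩ := hv
  have hpos : 0 < ∑ i, lam i := by
    refine (Finset.sum_nonneg fun i _ => h0 i).lt_of_ne fun h => hv0 ?_
    have hz := (Finset.sum_eq_zero_iff_of_nonneg fun i _ => h0 i).1 h.symm
    rw [hvl]
    exact Finset.sum_eq_zero fun i hi => by rw [hz i hi, zero_smul]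
  set τ₀ := (∑ i, lam i)⁻¹ with hτ₀
  have hτ₀pos : 0 < τ₀ := inv_pos.2 hpos
  have hmem : τ₀ • v ∈ convexHull ℝ (w '' s) := by
    rw [hvl]
    exact inv_sum_smul_mem_convexHull h0 hs hpos
  let R : Set ℝ := {τ | τ • v ∈ convexHull ℝ (w '' s)}
  have hRc : IsCompact R :=
    (isClosedEmbedding_smul_left hv0).isCompact_preimage hC
  obtain ⟨τ, hτR, hτ⟩ := hRc.exists_isGreatest ⟨τ₀, hmem⟩
  have hτpos : 0 < τ := hτ₀pos.trans_le (hτ hmem)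
  refine ⟨τ, hτpos, mem_endSet_convexHull_image.2 ⟨hτR, fun μ hμ hmu => ?_⟩⟩
  rw [smul_smul] at hmu
  have := hτ hmu
  nlinarith

theorem exists_inner_eq_one_of_mem_endSet [InnerProductSpace ℝ E] [CompleteSpace E] [Fintype ι]
    {w : ι → E} {s : Finset ι} {u : E} (hu : u ∈ endSet (convexHull ℝ (w '' s))) :
    ∃ d : E, ⟪u, d⟫ = 1 ∧ ∀ i ∈ s, ⟪w i, d⟫ ≤ 1 := by
  rw [mem_endSet_convexHull_image] at hu
  have hnot : u ∉ finCone (fun i => w i - u) s := by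
    rintro ⟨lam, h0, hs, hul⟩
    have hsum : (1 + ∑ i, lam i) • u = ∑ i, lam i • w i := by
      simp only [smul_sub, Finset.sum_sub_distrib, ← Finset.sum_smul] at hul
      rw [add_smul, one_smul]
      exact eq_sub_iff_add_eq.1 hul
    rcases (Finset.sum_nonneg fun i _ => h0 i : 0 ≤ ∑ i, lam i).eq_or_lt with h | h
    · have hz := (Finset.sum_eq_zero_iff_of_nonneg fun i _ => h0 i).1 h.symm
      have hu0 : u = 0 := by
        rw [hul]
        exact Finset.sum_eq_zero fun i hi => by rw [hz i hi, zero_smul]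
      have := hu.2 2 one_lt_two
      rw [hu0, smul_zero, ← hu0] at this
      exact this hu.1
    · refine hu.2 ((∑ i, lam i)⁻¹ * (1 + ∑ i, lam i)) ?_ ?_
      · rw [mul_add, mul_one, inv_mul_cancel₀ h.ne']
        have := inv_pos.2 h
        linarith
      · rw [mul_smul, hsum]
        exact inv_sum_smul_mem_convexHull h0 hs h
  obtain ⟨d, hd, hud⟩ := exists_inner_pos_of_notMem_finCone hnot
  refine ⟨(⟪u, d⟫)⁻¹ • d, ?_, fun i hi => ?_⟩
  · rw [inner_smul_right, inv_mul_cancel₀ hud.ne']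
  · have := hd i hi
    rw [inner_sub_left] at this
    rw [inner_smul_right, inv_mul_le_iff₀ hud]
    linarith

theorem inner_le_of_mem_convexHull [InnerProductSpace ℝ E] {G : Set E} {u x : E} {r : ℝ}
    (hu : u ∈ convexHull ℝ G) (h : ∀ g ∈ G, ⟪g, x⟫ ≤ r) : ⟪u, x⟫ ≤ r := by
  have hconv : Convex ℝ {g : E | ⟪g, x⟫ ≤ r} := by
    have := convex_halfSpace_le (𝕜 := ℝ) (f := fun g : E => ⟪g, x⟫)
      ⟨fun a b => inner_add_left a b x, fun c a => by simp [inner_smul_left]⟩ r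
    exact this
  exact convexHull_min h hconv hu

end EndSet

section Parametric

variable {n m : ℕ} {a : Fin m → EuclideanSpace ℝ (Fin n)} {c : EuclideanSpace ℝ (Fin n)}
  {D S : Finset (Fin m)} {b : Fin m → ℝ} {x : EuclideanSpace ℝ (Fin n)}

/-- The feasible points at which the constraints indexed by `D` are active. -/
def FeasEq (a : Fin m → EuclideanSpace ℝ (Fin n)) (D : Finset (Fin m)) (b : Fin m → ℝ) :
    Set (EuclideanSpace ℝ (Fin n)) :=
  {x | x ∈ Feas a b ∧ ∀ t ∈ D, ⟪a t, x⟫ = b t}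

theorem exists_subset_mem_Mc (h : InCone a S (-c)) : ∃ D ⊆ S, D ∈ Mc a c := by
  classical
  obtain ⟨D, hDS, hD⟩ := exists_minimal_le_of_wellFoundedLT (fun D => InCone a D (-c)) S h
  exact ⟨D, hDS, hD.1, fun D' hD' hc => le_antisymm hD' (hD.2 hc hD')⟩

theorem inner_eq_of_inCone {lam : Fin m → ℝ} (h : -c = ∑ t, lam t • a t)
    (x : EuclideanSpace ℝ (Fin n)) : ⟪c, x⟫ = -∑ t, lam t * ⟪a t, x⟫ := by
  rw [← neg_neg c, h, inner_neg_left, sum_inner]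
  simp [inner_smul_left]

theorem FeasEq_subset_Fop (hD : InCone a D (-c)) : FeasEq a D b ⊆ Fop a c b := by
  rintro x ⟨hx, hxD⟩
  obtain ⟨lam, h0, hs, hc⟩ := hD
  refine ⟨hx, fun y hy => ?_⟩
  rw [inner_eq_of_inCone hc, inner_eq_of_inCone hc, neg_le_neg_iff]
  refine Finset.sum_le_sum fun t _ => ?_
  by_cases ht : t ∈ D
  · rw [hxD t ht]
    exact mul_le_mul_of_nonneg_left (hy t) (h0 t)
  · simp [hs t ht]

theorem Fop_eq_FeasEq (hD : D ∈ Mc a c) (hne : (FeasEq a D b).Nonempty) :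
    Fop a c b = FeasEq a D b := by
  refine Subset.antisymm (fun y hy => ⟨hy.1, fun t ht => ?_⟩) (FeasEq_subset_Fop hD.1)
  obtain ⟨x, hx⟩ := hne
  obtain ⟨lam, h0, hs, hc⟩ := hD.1
  have hle := hy.2 x hx.1
  rw [inner_eq_of_inCone hc, inner_eq_of_inCone hc, neg_le_neg_iff] at hle
  have hterm : ∀ i ∈ Finset.univ, lam i * ⟪a i, y⟫ ≤ lam i * ⟪a i, x⟫ := by
    intro i _
    by_cases hi : i ∈ D
    · rw [hx.2 i hi]
      exact mul_le_mul_of_nonneg_left (hy.1 i) (h0 i)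
    · simp [hs i hi]
  have heq := (Finset.sum_eq_sum_iff_of_le hterm).1
    (le_antisymm (Finset.sum_le_sum hterm) hle) t (Finset.mem_univ t)
  have hlam : lam t ≠ 0 := by
    intro h
    have := hD.2 (D.erase t) (Finset.erase_subset _ _) ⟨lam, h0, fun i hi => by
      by_cases hit : i = t
      · rw [hit, h]
      · exact hs i fun hiD => hi (Finset.mem_erase.2 ⟨hit, hiD⟩), hc⟩
    exact Finset.erase_eq_self.1 this ht
  rw [mul_left_cancel₀ hlam heq, hx.2 t ht]

theorem exists_inCone_active_of_mem_Fop (hx : x ∈ Fop a c b) :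
    ∃ S : Finset (Fin m), InCone a S (-c) ∧ ∀ t ∈ S, ⟪a t, x⟫ = b t := by
  classical
  refine ⟨Finset.univ.filter fun t => ⟪a t, x⟫ = b t, ?_, by simp⟩
  refine mem_finCone_of_isMax (A := Finset.univ) (x := x) (β := b) (fun t _ => hx.1 t)
    (fun y hy => ?_) (by simp)
  simpa using hx.2 y fun t => hy t (Finset.mem_univ t)

theorem exists_mem_FeasEq_of_mem_Fop (hx : x ∈ Fop a c b) : ∃ D ∈ Mc a c, x ∈ FeasEq a D b := by
  obtain ⟨S, hS, hact⟩ := exists_inCone_active_of_mem_Fop hx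
  obtain ⟨D, hDS, hD⟩ := exists_subset_mem_Mc hS
  exact ⟨D, hD, hx.1, fun t ht => hact t (hDS ht)⟩

theorem Fop_nonempty (hc : InCone a Finset.univ (-c)) (hb : (Feas a b).Nonempty) :
    (Fop a c b).Nonempty := by
  classical
  obtain ⟨lam, h0, -, hlam⟩ := hc
  let V : Set ℝ := (fun x => ⟪c, x⟫) '' Feas a b
  have hbdd : BddBelow V := by
    refine ⟨-∑ t, lam t * b t, ?_⟩
    rintro _ ⟨y, hy, rfl⟩
    dsimp only
    rw [inner_eq_of_inCone hlam, neg_le_neg_iff]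
    exact Finset.sum_le_sum fun t _ => mul_le_mul_of_nonneg_left (hy t) (h0 t)
  let f : EuclideanSpace ℝ (Fin n) →ₗ[ℝ] ℝ × (Fin m → ℝ) :=
    LinearMap.prod (innerₗ _ c) (LinearMap.pi fun t => innerₗ _ (a t))
  let w : Fin m → ℝ × (Fin m → ℝ) := fun t => (0, Pi.single t 1)
  have hcl := isClosed_range_add_finCone f w Finset.univ
  have hsum : ∀ μ : Fin m → ℝ, ∑ t, μ t • w t = (0, μ) := by
    intro μ
    refine Prod.ext ?_ ?_
    · simp [w, Prod.fst_sum]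
    · simp only [w, Prod.snd_sum, Prod.smul_snd]
      ext i
      simp [Finset.sum_apply, Pi.single_apply]
  have hcl' := hcl.preimage (f := fun r : ℝ => (r, b)) (by fun_prop)
  have hmem : sInf V ∈ (fun r : ℝ => (r, b)) ⁻¹' {z | ∃ x, z - f x ∈ finCone w Finset.univ} := by
    refine closure_minimal ?_ hcl' (csInf_mem_closure (hb.image _) hbdd)
    rintro _ ⟨y, hy, rfl⟩
    refine ⟨y, fun t => b t - ⟪a t, y⟫, fun t => sub_nonneg.2 (hy t), by simp, ?_⟩
    rw [hsum]
    refine Prod.ext ?_ ?_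
    · simp [f]
    · ext t
      simp [f]
  obtain ⟨x, μ, hμ, -, hx⟩ := hmem
  rw [hsum, Prod.ext_iff] at hx
  refine ⟨x, fun t => ?_, fun y hy => ?_⟩
  · have hval : b t - ⟪a t, x⟫ = μ t := congrFun hx.2 t
    linarith [hμ t]
  · have hval : sInf V - ⟪c, x⟫ = 0 := hx.1
    have h2 : sInf V ≤ ⟪c, y⟫ := csInf_le hbdd ⟨y, hy, rfl⟩
    linarith

theorem isClosed_setOf_FeasEq_nonempty (a : Fin m → EuclideanSpace ℝ (Fin n))
    (D : Finset (Fin m)) : IsClosed {b | (FeasEq a D b).Nonempty} := by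
  classical
  let f : EuclideanSpace ℝ (Fin n) →ₗ[ℝ] (Fin m → ℝ) := LinearMap.pi fun t => innerₗ _ (a t)
  have hsum : ∀ μ : Fin m → ℝ,
      ∑ t, μ t • (Pi.single t 1 : Fin m → ℝ) = μ := by
    intro μ
    ext i
    simp [Finset.sum_apply, Pi.single_apply]
  suffices h : {b | (FeasEq a D b).Nonempty} =
      {z | ∃ x, z - f x ∈ finCone (fun t => (Pi.single t 1 : Fin m → ℝ)) Dᶜ} by
    rw [h]
    exact isClosed_range_add_finCone f _ _
  ext b
  refine exists_congr fun x => ⟨fun hx => ⟨fun t => b t - ⟪a t, x⟫, fun t => sub_nonneg.2 (hx.1 t),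
    fun t ht => ?_, ?_⟩, ?_⟩
  · exact sub_eq_zero.2 (hx.2 t (by simpa using ht)).symm
  · rw [hsum]
    ext t
    simp [f]
  · rintro ⟨μ, hμ, hD, h⟩
    rw [hsum] at h
    have hval : ∀ t, b t - ⟪a t, x⟫ = μ t := fun t => by simpa [f] using congrFun h t
    exact ⟨fun t => by linarith [hval t, hμ t],
      fun t ht => by linarith [hval t, hD t (by simpa using ht)]⟩

theorem exists_pos_forall_Fop_subset (a : Fin m → EuclideanSpace ℝ (Fin n))
    (c : EuclideanSpace ℝ (Fin n)) :
    ∃ δ : ℝ, 0 < δ ∧ ∀ c', dist c' c < δ → ∀ b, Fop a c' b ⊆ Fop a c b := by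
  have hev : ∀ᶠ c' in nhds c, ∀ S : Finset (Fin m), InCone a S (-c') → InCone a S (-c) := by
    rw [Filter.eventually_all]
    intro S
    by_cases h : InCone a S (-c)
    · exact Filter.Eventually.of_forall fun _ _ => h
    · have hopen : IsOpen {c' | -c' ∉ finCone a S} :=
        ((isClosed_finCone a S).preimage continuous_neg).isOpen_compl
      filter_upwards [hopen.mem_nhds h] with c' hc' hcone
      exact absurd hcone hc'
  obtain ⟨δ, hδ, h⟩ := Metric.eventually_nhds_iff.1 hev
  refine ⟨δ, hδ, fun c' hc' b x hx => ?_⟩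
  obtain ⟨S, hS, hact⟩ := exists_inCone_active_of_mem_Fop hx
  exact FeasEq_subset_Fop (h hc' S hS) ⟨hx.1, hact⟩

/-- The polytope `conv {a t, t ∈ S; -a t, t ∈ D}` is the convex hull of a finite family. -/
theorem image_union_image_neg (a : Fin m → EuclideanSpace ℝ (Fin n)) (S D : Finset (Fin m)) :
    a '' (S : Set (Fin m)) ∪ (fun t => -a t) '' (D : Set (Fin m)) =
      Sum.elim a (fun t => -a t) '' (S.disjSum D : Finset (Fin m ⊕ Fin m)) := by
  ext z
  simp [Finset.mem_disjSum, Sum.exists]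

theorem isClosed_FeasEq : IsClosed (FeasEq a D b) := by
  have h : FeasEq a D b = (⋂ t, {x | ⟪a t, x⟫ ≤ b t}) ∩ ⋂ t ∈ D, {x | ⟪a t, x⟫ = b t} := by
    ext x
    simp [FeasEq, Feas]
  rw [h]
  exact (isClosed_iInter fun t => isClosed_le (by fun_prop) continuous_const).inter
    (isClosed_biInter fun t _ => isClosed_eq (by fun_prop) continuous_const)

theorem convex_setOf_FeasEq (a : Fin m → EuclideanSpace ℝ (Fin n)) (D : Finset (Fin m)) :
    Convex ℝ {p : (Fin m → ℝ) × EuclideanSpace ℝ (Fin n) | p.2 ∈ FeasEq a D p.1} := by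
  rintro ⟨b, x⟩ ⟨h1, h2⟩ ⟨b', y⟩ ⟨k1, k2⟩ p q hp hq -
  refine ⟨fun t => ?_, fun t ht => ?_⟩
  · simp only [Prod.snd_add, Prod.smul_snd, Prod.fst_add, Prod.smul_fst, inner_add_right,
      inner_smul_right, Pi.add_apply, Pi.smul_apply, smul_eq_mul]
    exact add_le_add (mul_le_mul_of_nonneg_left (h1 t) hp) (mul_le_mul_of_nonneg_left (k1 t) hq)
  · simp only [Prod.snd_add, Prod.smul_snd, Prod.fst_add, Prod.smul_fst, inner_add_right,
      inner_smul_right, Pi.add_apply, Pi.smul_apply, smul_eq_mul]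
    have e1 := h2 t ht
    have e2 := k2 t ht
    dsimp only at e1 e2
    rw [e1, e2]

theorem convex_FeasEq : Convex ℝ (FeasEq a D b) := by
  intro x hx y hy p q hp hq hpq
  have := convex_setOf_FeasEq a D (x := (b, x)) hx (y := (b, y)) hy hp hq hpq
  simpa [← add_smul, hpq] using this

theorem convex_setOf_FeasEq_nonempty (a : Fin m → EuclideanSpace ℝ (Fin n))
    (D : Finset (Fin m)) : Convex ℝ {b | (FeasEq a D b).Nonempty} := by
  rintro b ⟨x, hx⟩ b' ⟨y, hy⟩ p q hp hq hpq
  exact ⟨p • x + q • y,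
    convex_setOf_FeasEq a D (x := (b, x)) hx (y := (b', y)) hy hp hq hpq⟩

/-- Lipschitz estimate for the system with the constraints in `D` turned into equations. -/
theorem exists_mem_FeasEq_edist_le {K : ℝ≥0∞} {b' : Fin m → ℝ}
    (hK : ∀ S, D ⊆ S → (Metric.infEDist (0 : EuclideanSpace ℝ (Fin n))
      (endSet (convexHull ℝ (a '' (S : Set (Fin m)) ∪
        (fun t => -a t) '' (D : Set (Fin m))))))⁻¹ ≤ K)
    (hx : x ∈ FeasEq a D b') (hne : (FeasEq a D b).Nonempty) :
    ∃ y ∈ FeasEq a D b, edist x y ≤ K * edist b' b := by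
  classical
  obtain ⟨y, hy, hmin⟩ := exists_norm_eq_iInf_of_complete_convex hne
    isClosed_FeasEq.isComplete convex_FeasEq x
  rw [norm_eq_iInf_iff_real_inner_le_zero convex_FeasEq hy] at hmin
  refine ⟨y, hy, ?_⟩
  rcases eq_or_ne x y with rfl | hxy
  · simp
  let S : Finset (Fin m) := Finset.univ.filter fun t => ⟪a t, y⟫ = b t
  have hDS : D ⊆ S := fun t ht => by simp [S, hy.2 t ht]
  have hcone : x - y ∈ finCone (Sum.elim a (fun t => -a t)) (S.disjSum D) := by
    refine mem_finCone_of_isMax (A := Finset.univ.disjSum D)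
      (β := Sum.elim b (fun t => -b t)) (x := y) ?_ (fun w hw => ?_) ?_
    · rintro (t | t) ht
      · simpa using hy.1 t
      · have hD : t ∈ D := by simpa using ht
        simp [hy.2 t hD]
    · have hwF : w ∈ FeasEq a D b := by
        have h1 : ∀ t, ⟪a t, w⟫ ≤ b t := fun t => by simpa using hw (.inl t) (by simp)
        refine ⟨h1, fun t ht => le_antisymm (h1 t) ?_⟩
        simpa using hw (.inr t) (by simpa using ht)
      have := hmin w hwF
      rw [inner_sub_right] at this
      linarith
    · rintro (t | t) ht h
      · simpa [S] using h
      · simpa using ht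
  obtain ⟨τ, hτ, hend⟩ := exists_pos_smul_mem_endSet hcone (sub_ne_zero.2 hxy)
  have hle : ⟪τ • (x - y), x - y⟫ ≤ dist b' b := by
    refine inner_le_of_mem_convexHull (mem_endSet_convexHull_image.1 hend).1 ?_
    rintro _ ⟨t | t, ht, rfl⟩
    · have htS : ⟪a t, y⟫ = b t := by simpa [S] using ht
      have h1 := hx.1 t
      have h2 := dist_le_pi_dist b' b t
      rw [Real.dist_eq] at h2
      simp only [Sum.elim_inl, inner_sub_right]
      linarith [le_abs_self (b' t - b t)]
    · have htD : t ∈ D := by simpa using ht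
      have h1 := hx.2 t htD
      have h3 := hy.2 t htD
      have h2 := dist_le_pi_dist b' b t
      rw [Real.dist_eq] at h2
      simp only [Sum.elim_inr, inner_neg_left, inner_sub_right]
      linarith [neg_abs_le (b' t - b t)]
  have hprod : ‖x - y‖ * ‖τ • (x - y)‖ ≤ dist b' b := by
    rw [norm_smul, Real.norm_of_nonneg hτ.le]
    rw [real_inner_smul_left, real_inner_self_eq_norm_sq] at hle
    linarith
  have hu0 : τ • (x - y) ≠ 0 := smul_ne_zero hτ.ne' (sub_ne_zero.2 hxy)
  have hKu : (‖τ • (x - y)‖ₑ)⁻¹ ≤ K := by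
    refine le_trans (ENNReal.inv_le_inv.2 ?_) (hK S hDS)
    rw [image_union_image_neg]
    refine (Metric.infEDist_le_edist_of_mem hend).trans_eq ?_
    rw [edist_eq_enorm_sub, zero_sub, enorm_neg]
  have hprod' : ‖x - y‖ₑ * ‖τ • (x - y)‖ₑ ≤ edist b' b := by
    rw [edist_dist, ← ofReal_norm, ← ofReal_norm, ← ENNReal.ofReal_mul (norm_nonneg _)]
    exact ENNReal.ofReal_le_ofReal hprod
  calc edist x y = ‖x - y‖ₑ := edist_eq_enorm_sub x y
    _ ≤ edist b' b / ‖τ • (x - y)‖ₑ :=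
        (ENNReal.le_div_iff_mul_le (.inl (by simpa using hu0)) (.inl (by simp))).2 hprod'
    _ = (‖τ • (x - y)‖ₑ)⁻¹ * edist b' b := by rw [ENNReal.div_eq_inv_mul]
    _ ≤ K * edist b' b := by gcongr

/-- A transitive relation which holds locally on each member of a finite closed cover of `[0, 1]`
by order-connected sets holds between `0` and every point. -/
theorem rel_zero_of_finite_cover {κ : Type*} {A : κ → Set ℝ} (hcl : ∀ i, IsClosed (A i))
    {R : ℝ → ℝ → Prop} (htrans : ∀ r s t, 0 ≤ r → r ≤ s → s ≤ t → R r s → R s t → R r t)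
    (hR : ∀ i, ∀ s ∈ A i, ∀ t ∈ A i, 0 ≤ s → s ≤ t → R s t) (I : Finset κ) {t : ℝ} (ht : 0 ≤ t)
    (hcov : ∀ s ∈ Icc 0 t, ∃ i ∈ I, s ∈ A i) : R 0 t := by
  classical
  induction I using Finset.strongInduction generalizing t with
  | H I ih =>
  obtain ⟨i, hi, hti⟩ := hcov t ⟨ht, le_rfl⟩
  obtain ⟨s, ⟨hsA, hs0, hst⟩, hleast⟩ :=
    ((isCompact_Icc (a := 0) (b := t)).inter_left (hcl i)).exists_isLeast ⟨t, hti, ht, le_rfl⟩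
  have hRst := hR i s hsA t hti hs0 hst
  rcases hs0.eq_or_lt with rfl | hspos
  · exact hRst
  refine htrans 0 s t le_rfl hs0 hst (ih (I.erase i) (Finset.erase_ssubset hi) hs0 ?_) hRst
  have hclosed : IsClosed (⋃ j ∈ (I.erase i : Finset κ), A j) :=
    (Finset.finite_toSet _).isClosed_biUnion fun j _ => hcl j
  have hsub : Ico 0 s ⊆ ⋃ j ∈ (I.erase i : Finset κ), A j := by
    intro r hr
    obtain ⟨j, hj, hrj⟩ := hcov r ⟨hr.1, hr.2.le.trans hst⟩
    have hne : j ≠ i := by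
      rintro rfl
      exact hr.2.not_ge (hleast ⟨hrj, hr.1, hr.2.le.trans hst⟩)
    exact mem_biUnion (Finset.mem_erase.2 ⟨hne, hj⟩) hrj
  have hsub' := closure_minimal hsub hclosed
  rw [closure_Ico hspos.ne] at hsub'
  intro r hr
  simpa using hsub' hr

/-- Global Lipschitz estimate for the argmin mapping with fixed objective. -/
theorem infEDist_Fop_le {K : ℝ≥0∞} {b' : Fin m → ℝ}
    (hK : ∀ D ∈ Mc a c, ∀ S, D ⊆ S → (Metric.infEDist (0 : EuclideanSpace ℝ (Fin n))
      (endSet (convexHull ℝ (a '' (S : Set (Fin m)) ∪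
        (fun t => -a t) '' (D : Set (Fin m))))))⁻¹ ≤ K)
    (hc : InCone a Finset.univ (-c)) (hb : (Feas a b).Nonempty) (hx : x ∈ Fop a c b') :
    Metric.infEDist x (Fop a c b) ≤ K * edist b' b := by
  classical
  let β : ℝ → Fin m → ℝ := AffineMap.lineMap b b'
  have hβ : Continuous β := AffineMap.lineMap_continuous
  have hfeas : ∀ s ∈ Icc (0 : ℝ) 1, (Fop a c (β s)).Nonempty := by
    intro s hs
    refine Fop_nonempty hc ?_
    obtain ⟨y, hy⟩ := hb
    have h := convex_setOf_FeasEq_nonempty a ∅ (x := b) ⟨y, hy, by simp⟩ (y := b')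
      ⟨x, hx.1, by simp⟩ (sub_nonneg.2 hs.2) hs.1 (sub_add_cancel _ _)
    obtain ⟨w, hw, -⟩ := h
    refine ⟨w, ?_⟩
    convert hw using 2
    simp [β, AffineMap.lineMap_apply_module]
  let A : {D // D ∈ Mc a c} → Set ℝ := fun D => β ⁻¹' {b | (FeasEq a D.1 b).Nonempty}
  let R : ℝ → ℝ → Prop := fun s t => ∀ z ∈ Fop a c (β t), ∃ y ∈ Fop a c (β s),
    edist z y ≤ K * (ENNReal.ofReal (t - s) * edist b' b)
  have h01 : R 0 1 := by
    refine rel_zero_of_finite_cover (A := A)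
      (fun D => (isClosed_setOf_FeasEq_nonempty a D.1).preimage hβ) ?_ ?_ Finset.univ zero_le_one ?_
    · intro r s t hr hrs hst h1 h2 z hz
      obtain ⟨y, hy, hzy⟩ := h2 z hz
      obtain ⟨w, hw, hyw⟩ := h1 y hy
      refine ⟨w, hw, (edist_triangle z y w).trans ((add_le_add hzy hyw).trans_eq ?_)⟩
      rw [← mul_add, ← add_mul, ← ENNReal.ofReal_add (by linarith) (by linarith)]
      congr 3
      ring
    · intro D s hs t ht hs0 hst z hz
      rw [Fop_eq_FeasEq D.2 ht] at hz
      rw [Fop_eq_FeasEq D.2 hs]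
      obtain ⟨y, hy, hzy⟩ := exists_mem_FeasEq_edist_le (hK D.1 D.2) hz hs
      refine ⟨y, hy, hzy.trans_eq ?_⟩
      congr 1
      rw [edist_dist, dist_lineMap_lineMap, ENNReal.ofReal_mul dist_nonneg, edist_comm b' b,
        edist_dist b b', Real.dist_eq, abs_of_nonneg (sub_nonneg.2 hst)]
    · intro s hs
      obtain ⟨y, hy⟩ := hfeas s hs
      obtain ⟨D, hD, hyD⟩ := exists_mem_FeasEq_of_mem_Fop hy
      exact ⟨⟨D, hD⟩, Finset.mem_univ _, y, hyD⟩
  obtain ⟨y, hy, hxy⟩ := h01 x (by simpa [β] using hx)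
  have hy' : y ∈ Fop a c b := by simpa [β] using hy
  exact (Metric.infEDist_le_edist_of_mem hy').trans (by simpa using hxy)

theorem exists_inner_ne_zero_of_mem_span {v : EuclideanSpace ℝ (Fin n)}
    (hv : v ∈ Submodule.span ℝ (range a)) (hv0 : v ≠ 0) : ∃ t, ⟪a t, v⟫ ≠ 0 := by
  by_contra! h
  have hle : Submodule.span ℝ (range a) ≤ LinearMap.ker (innerₗ _ v) := by
    rw [Submodule.span_le]
    rintro _ ⟨t, rfl⟩
    simpa [real_inner_comm] using h t
  have := hle hv
  simp [hv0] at this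

/-- Every point of `Feas a b ∩ span a` can be moved to an extreme point without losing active
constraints. -/
theorem exists_extremePoint_activeSet_subset
    (hx : x ∈ Feas a b ∩ Submodule.span ℝ (range a)) :
    ∃ y ∈ extremePoints ℝ (Feas a b ∩ Submodule.span ℝ (range a)),
      activeSet a b x ⊆ activeSet a b y := by
  classical
  let P : Finset (Fin m) → Prop := fun A => ∃ y ∈ Feas a b ∩ Submodule.span ℝ (range a),
    activeSet a b x ⊆ activeSet a b y ∧ (A : Set (Fin m)) = activeSet a b y
  obtain ⟨A, -, ⟨⟨y, hy, hxy, hA⟩, hAmax⟩⟩ := exists_maximal_ge_of_wellFoundedGT P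
    (Finset.univ.filter fun t => t ∈ activeSet a b x) ⟨x, hx, subset_rfl, by simp⟩
  have key : ∀ v ∈ Submodule.span ℝ (range a), (∀ t ∈ activeSet a b y, ⟪a t, v⟫ = 0) →
      ∀ t, ⟪a t, v⟫ ≤ 0 := by
    intro v hv hva
    by_contra! hpos
    obtain ⟨t₁, ht₁⟩ := hpos
    obtain ⟨t₀, ht₀, hmin⟩ := Finset.exists_min_image (Finset.univ.filter fun t => 0 < ⟪a t, v⟫)
      (fun t => (b t - ⟪a t, y⟫) / ⟪a t, v⟫) ⟨t₁, by simpa using ht₁⟩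
    simp only [Finset.mem_filter, Finset.mem_univ, true_and] at ht₀ hmin
    set r := (b t₀ - ⟪a t₀, y⟫) / ⟪a t₀, v⟫ with hr
    have hr0 : 0 ≤ r := div_nonneg (sub_nonneg.2 (hy.1 t₀)) ht₀.le
    let z := y + r • v
    have hz : ∀ t, ⟪a t, z⟫ = ⟪a t, y⟫ + r * ⟪a t, v⟫ := fun t => by
      simp [z, inner_add_right, inner_smul_right]
    have hyz : activeSet a b y ⊆ activeSet a b z := by
      intro t ht
      change ⟪a t, z⟫ = b t
      rw [hz, hva t ht, mul_zero, add_zero]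
      exact ht
    have hzF : z ∈ Feas a b := by
      intro t
      rw [hz]
      rcases le_or_gt ⟪a t, v⟫ 0 with h | h
      · nlinarith [hy.1 t]
      · have := hmin t h
        rw [le_div_iff₀ h] at this
        linarith
    have hPz : P (Finset.univ.filter fun t => t ∈ activeSet a b z) :=
      ⟨z, ⟨hzF, Submodule.add_mem _ hy.2 (Submodule.smul_mem _ _ hv)⟩, hxy.trans hyz, by simp⟩
    have hle := hAmax hPz (fun t ht => by
      simpa using hyz (hA ▸ (Finset.mem_coe.2 ht)))
    have ht₀z : t₀ ∈ activeSet a b z := by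
      change ⟪a t₀, z⟫ = b t₀
      rw [hz, hr, div_mul_cancel₀ _ ht₀.ne']
      ring
    have ht₀A : t₀ ∈ (A : Set (Fin m)) := hle (by simpa using ht₀z)
    rw [hA] at ht₀A
    exact ht₀.ne' (hva t₀ ht₀A)
  refine ⟨y, mem_extremePoints_iff_left.2 ⟨hy, fun p hp q hq hpq => ?_⟩, hxy⟩
  obtain ⟨α, β, hα, hβ, hαβ, rfl⟩ := hpq
  by_contra hne
  have hact : ∀ t ∈ activeSet a b (α • p + β • q), ⟪a t, p⟫ = b t ∧ ⟪a t, q⟫ = b t := by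
    intro t ht
    have ht' : α * ⟪a t, p⟫ + β * ⟪a t, q⟫ = b t := by
      simpa [activeSet, inner_add_right, inner_smul_right] using ht
    have h1 := hp.1 t
    have h2 := hq.1 t
    have e : α * (b t - ⟪a t, p⟫) + β * (b t - ⟪a t, q⟫) = 0 := by
      linear_combination (b t) * hαβ - ht'
    have n1 := mul_nonneg hα.le (sub_nonneg.2 h1)
    have n2 := mul_nonneg hβ.le (sub_nonneg.2 h2)
    have z1 : α * (b t - ⟪a t, p⟫) = 0 := by linarith
    have z2 : β * (b t - ⟪a t, q⟫) = 0 := by linarith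
    rcases mul_eq_zero.1 z1 with h | h
    · exact absurd h hα.ne'
    rcases mul_eq_zero.1 z2 with h' | h'
    · exact absurd h' hβ.ne'
    exact ⟨by linarith, by linarith⟩
  have hv : p - q ∈ Submodule.span ℝ (range a) := Submodule.sub_mem _ hp.2 hq.2
  have hv0 : p - q ≠ 0 := by
    intro h
    rw [sub_eq_zero] at h
    exact hne (by rw [h, ← add_smul, hαβ, one_smul])
  obtain ⟨t, ht⟩ := exists_inner_ne_zero_of_mem_span hv hv0
  have hz : ∀ t ∈ activeSet a b (α • p + β • q), ⟪a t, p - q⟫ = 0 := fun t ht => by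
    rw [inner_sub_right, (hact t ht).1, (hact t ht).2, sub_self]
  have h1 := key (p - q) hv hz t
  have h2 := key (-(p - q)) (Submodule.neg_mem _ hv)
    (fun t ht => by rw [inner_neg_right, hz t ht, neg_zero]) t
  rw [inner_neg_right] at h2
  exact ht (le_antisymm h1 (by linarith))

/-- Points near a suitable extreme optimal point realising the growth rate `‖u‖⁻¹` for every `u`
in the end set attached to `(D, S)`. -/
theorem exists_Eop_perturbation (hD : D ∈ Mc a c) (hDS : D ⊆ S) :
    ∃ b, (Feas a b).Nonempty ∧ ∃ x₀ ∈ Eop a c b,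
      ∀ u ∈ endSet (convexHull ℝ (a '' (S : Set (Fin m)) ∪
        (fun t => -a t) '' (D : Set (Fin m)))), ∀ δ : ℝ, 0 < δ →
      ∃ ε : ℝ, 0 < ε ∧ ε < δ ∧ ∃ x, dist x x₀ < δ ∧ ∃ b', dist b' b ≤ ε ∧ x ∈ Fop a c b' ∧
        ∀ y ∈ Fop a c b, ε ≤ ‖u‖ * dist x y := by
  classical
  let b : Fin m → ℝ := fun t => if t ∈ S then 0 else 1
  have h0F : (0 : EuclideanSpace ℝ (Fin n)) ∈ Feas a b := by
    intro t
    simp only [inner_zero_right, b]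
    split_ifs <;> norm_num
  obtain ⟨x₀, hx₀, hact⟩ := exists_extremePoint_activeSet_subset ⟨h0F, Submodule.zero_mem _⟩
  have hx₀S : ∀ t ∈ S, ⟪a t, x₀⟫ = 0 := by
    intro t ht
    have h : t ∈ activeSet a b 0 := by simp [activeSet, b, ht]
    have : ⟪a t, x₀⟫ = b t := hact h
    simpa [b, ht] using this
  have hx₀FE : x₀ ∈ FeasEq a D b :=
    ⟨hx₀.1.1, fun t ht => by rw [hx₀S t (hDS ht)]; simp [b, hDS ht]⟩
  have hFop : Fop a c b = FeasEq a D b := Fop_eq_FeasEq hD ⟨x₀, hx₀FE⟩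
  refine ⟨b, ⟨0, h0F⟩, x₀, ?_, ?_⟩
  · refine inter_extremePoints_subset_extremePoints_of_subset
      (inter_subset_inter_left _ fun y hy => hy.1) ⟨⟨?_, hx₀.1.2⟩, hx₀⟩
    rw [hFop]
    exact hx₀FE
  intro u hu δ hδ
  rw [image_union_image_neg] at hu
  obtain ⟨d, hud, hd⟩ := exists_inner_eq_one_of_mem_endSet hu
  have hdS : ∀ t ∈ S, ⟪a t, d⟫ ≤ 1 := fun t ht => by simpa using hd (.inl t) (by simpa using ht)
  have hdD : ∀ t ∈ D, -⟪a t, d⟫ ≤ 1 := fun t ht => by simpa using hd (.inr t) (by simpa using ht)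
  obtain ⟨s, hs0, hs1, hsδ⟩ : ∃ s : ℝ, 0 < s ∧ s < 1 ∧ s * ‖x₀‖ < δ / 2 := by
    refine ⟨min (1 / 2) (δ / 2 / (‖x₀‖ + 1)), by positivity,
      (min_le_left _ _).trans_lt (by norm_num), ?_⟩
    calc _ ≤ δ / 2 / (‖x₀‖ + 1) * ‖x₀‖ := by gcongr; exact min_le_right _ _
      _ < δ / 2 / (‖x₀‖ + 1) * (‖x₀‖ + 1) := by gcongr; linarith
      _ = δ / 2 := by field_simp
  let M : ℝ := 1 + ‖d‖ + ∑ t, |⟪a t, d⟫|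
  have hsum0 : 0 ≤ ∑ t, |⟪a t, d⟫| := Finset.sum_nonneg fun t _ => abs_nonneg _
  have hM : 0 < M := by positivity
  obtain ⟨ε, hε, hεM⟩ : ∃ ε : ℝ, 0 < ε ∧ ε * M ≤ min (δ / 2) s :=
    ⟨min (δ / 2) s / M, by positivity, by rw [div_mul_cancel₀ _ hM.ne']⟩
  have hεδ : ε * M ≤ δ / 2 := hεM.trans (min_le_left _ _)
  have hεs : ε * M ≤ s := hεM.trans (min_le_right _ _)
  have hε1 : ε ≤ ε * M := le_mul_of_one_le_right hε.le (by
    have := norm_nonneg d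
    simp only [M]
    linarith)
  have hεd : ε * ‖d‖ ≤ ε * M := mul_le_mul_of_nonneg_left (by simp only [M]; linarith) hε.le
  have hεa : ∀ t, ε * ⟪a t, d⟫ ≤ ε * M := by
    intro t
    refine mul_le_mul_of_nonneg_left ?_ hε.le
    have h1 := Finset.single_le_sum (f := fun t => |⟪a t, d⟫|) (fun t _ => abs_nonneg _)
      (Finset.mem_univ t)
    have := norm_nonneg d
    have := le_abs_self ⟪a t, d⟫
    simp only [M]
    linarith
  let x := (1 - s) • x₀ + ε • d
  have hxin : ∀ v, ⟪v, x⟫ = (1 - s) * ⟪v, x₀⟫ + ε * ⟪v, d⟫ := fun v => by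
    simp [x, inner_add_right, inner_smul_right]
  let b' : Fin m → ℝ := fun t => if t ∈ D then ε * ⟪a t, d⟫ else if t ∈ S then ε else 1
  refine ⟨ε, hε, by linarith, x, ?_, b', ?_, ?_, ?_⟩
  · rw [dist_eq_norm]
    have : x - x₀ = ε • d - s • x₀ := by
      simp only [x, sub_smul, one_smul]
      abel
    rw [this]
    calc _ ≤ ‖ε • d‖ + ‖s • x₀‖ := norm_sub_le _ _
      _ = ε * ‖d‖ + s * ‖x₀‖ := by
        rw [norm_smul, norm_smul, Real.norm_of_nonneg hε.le, Real.norm_of_nonneg hs0.le]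
      _ < δ := by linarith
  · refine (dist_pi_le_iff hε.le).2 fun t => ?_
    rw [Real.dist_eq, abs_le]
    by_cases htD : t ∈ D
    · have h1 := hdS t (hDS htD)
      have h2 := hdD t htD
      simp only [b', b, htD, hDS htD, if_true, sub_zero]
      constructor <;> nlinarith
    · by_cases htS : t ∈ S
      · simp [b', b, htD, htS, hε.le]
      · simp [b', b, htD, htS, hε.le]
  · refine FeasEq_subset_Fop hD.1 ⟨fun t => ?_, fun t ht => ?_⟩
    · rw [hxin]
      by_cases htD : t ∈ D
      · simp [b', htD, hx₀S t (hDS htD)]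
      · by_cases htS : t ∈ S
        · have := hdS t htS
          simp only [b', htD, htS, if_false, if_true, hx₀S t htS]
          nlinarith
        · have h1 : ⟪a t, x₀⟫ ≤ 1 := by simpa [b, htS] using hx₀.1.1 t
          have h2 := hεa t
          simp only [b', htD, htS, if_false]
          nlinarith
    · rw [hxin, hx₀S t (hDS ht)]
      simp [b', ht]
  · intro y hy
    rw [hFop] at hy
    have huC := (mem_endSet_convexHull_image.1 hu).1
    have hy0 : ⟪u, y⟫ ≤ 0 := by
      refine inner_le_of_mem_convexHull huC ?_
      rintro _ ⟨t | t, ht, rfl⟩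
      · have htS : t ∈ S := by simpa using ht
        simpa [b, htS] using hy.1 t
      · have htD : t ∈ D := by simpa using ht
        have := hy.2 t htD
        simp [this, b, hDS htD]
    have hx0 : ⟪u, -x₀⟫ ≤ 0 := by
      refine inner_le_of_mem_convexHull huC ?_
      rintro _ ⟨t | t, ht, rfl⟩
      · have htS : t ∈ S := by simpa using ht
        simp [hx₀S t htS]
      · have htD : t ∈ D := by simpa using ht
        simp [hx₀S t (hDS htD)]
    rw [inner_neg_right] at hx0
    calc ε ≤ ⟪u, x - y⟫ := by
          rw [inner_sub_right, hxin, hud]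
          nlinarith
      _ ≤ ‖u‖ * ‖x - y‖ := real_inner_le_norm _ _
      _ = ‖u‖ * dist x y := by rw [dist_eq_norm]

end Parametric

theorem ENNReal.div_infEDist_le {X : Type*} [PseudoEMetricSpace X] {x : X} {s : Set X}
    {d K : ℝ≥0∞} (h : ∀ y ∈ s, d ≤ K * edist x y) : d / Metric.infEDist x s ≤ K := by
  rcases s.eq_empty_or_nonempty with rfl | ⟨y₀, hy₀⟩
  · simp
  rcases eq_or_ne K 0 with rfl | hK0
  · have : d = 0 := by simpa using h y₀ hy₀
    simp [this]
  rcases eq_or_ne K ⊤ with rfl | hKt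
  · exact le_top
  refine ENNReal.div_le_of_le_mul ?_
  rw [mul_comm, ← ENNReal.div_le_iff_le_mul (.inl hK0) (.inl hKt)]
  refine Metric.le_infEDist.2 fun y hy => ?_
  rw [ENNReal.div_le_iff_le_mul (.inl hK0) (.inl hKt), mul_comm]
  exact h y hy

theorem inv_enorm_le_infEDist_div {E X : Type*} [NormedAddCommGroup E] [PseudoMetricSpace X]
    {u : E} {x : X} {A : Set X} (hA : A.Nonempty) {ε : ℝ} (hε : 0 < ε)
    (h : ∀ y ∈ A, ε ≤ ‖u‖ * dist x y) {e : ℝ≥0∞} (he : e ≤ ENNReal.ofReal ε) :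
    ‖u‖ₑ⁻¹ ≤ Metric.infEDist x A / e := by
  have hu : u ≠ 0 := by
    rintro rfl
    obtain ⟨y, hy⟩ := hA
    have := h y hy
    rw [norm_zero, zero_mul] at this
    exact hε.not_ge this
  have hue : ‖u‖ₑ ≠ 0 := by simpa using hu
  have hut : ‖u‖ₑ ≠ ⊤ := by simp
  have hle : ENNReal.ofReal ε / ‖u‖ₑ ≤ Metric.infEDist x A := by
    refine Metric.le_infEDist.2 fun y hy => ?_
    rw [ENNReal.div_le_iff_le_mul (.inl hue) (.inl hut), mul_comm, edist_dist, ← ofReal_norm,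
      ← ENNReal.ofReal_mul (norm_nonneg _)]
    exact ENNReal.ofReal_le_ofReal (h y hy)
  calc ‖u‖ₑ⁻¹ = ENNReal.ofReal ε / ‖u‖ₑ / ENNReal.ofReal ε := by
        rw [ENNReal.div_eq_inv_mul, div_eq_mul_inv, ← mul_assoc,
          ENNReal.inv_mul_cancel (by simpa using hε) ENNReal.ofReal_ne_top, one_mul]
    _ ≤ Metric.infEDist x A / e := ENNReal.div_le_div hle he

theorem inv_infEDist_zero_le {E : Type*} [NormedAddCommGroup E] {A : Set E} {L : ℝ≥0∞}
    (h : ∀ u ∈ A, ‖u‖ₑ⁻¹ ≤ L) : (Metric.infEDist 0 A)⁻¹ ≤ L := by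
  rw [ENNReal.inv_le_iff_inv_le]
  refine Metric.le_infEDist.2 fun u hu => ?_
  rw [edist_eq_enorm_sub, zero_sub, enorm_neg, ENNReal.inv_le_iff_inv_le]
  exact h u hu

section Moduli

variable {n m : ℕ} {a : Fin m → EuclideanSpace ℝ (Fin n)} {c : EuclideanSpace ℝ (Fin n)}
  {b : Fin m → ℝ} {K : ℝ≥0∞}

theorem hofConst_Fop_le (hLip : ∀ b, (Feas a b).Nonempty → ∀ b', ∀ x ∈ Fop a c b',
      Metric.infEDist x (Fop a c b) ≤ K * edist b' b) :
    hofConst (fun b => Fop a c b) ≤ K := by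
  refine iSup₂_le fun b hb => iSup_le fun x => ENNReal.div_infEDist_le fun b' hx => ?_
  rw [edist_comm]
  exact hLip b (hb.mono fun y hy => hy.1) b' x hx

theorem lipuscMod_Fop_le (hLip : ∀ b', ∀ x ∈ Fop a c b',
      Metric.infEDist x (Fop a c b) ≤ K * edist b' b) :
    lipuscMod (fun p : EuclideanSpace ℝ (Fin n) × (Fin m → ℝ) => Fop a p.1 p.2) (c, b) ≤ K := by
  obtain ⟨δ, hδ, hsub⟩ := exists_pos_forall_Fop_subset a c
  refine limsup_le_of_le (by isBoundedDefault) ?_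
  filter_upwards [Metric.ball_mem_nhds (c, b) hδ] with p hp
  refine iSup₂_le fun x hx => ENNReal.div_le_of_le_mul ?_
  have hp1 : dist p.1 c < δ := (le_max_left _ _).trans_lt hp
  exact (hLip p.2 x (hsub p.1 hp1 p.2 hx)).trans (mul_le_mul_right (le_max_right _ _) _)

theorem clmMod_Fop_le {x₀ : EuclideanSpace ℝ (Fin n)} (hx₀ : x₀ ∈ Fop a c b)
    (hLip : ∀ b', ∀ x ∈ Fop a c b', Metric.infEDist x (Fop a c b) ≤ K * edist b' b) :
    clmMod (fun p : EuclideanSpace ℝ (Fin n) × (Fin m → ℝ) => Fop a p.1 p.2) (c, b) x₀ ≤ K := by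
  obtain ⟨δ, hδ, hsub⟩ := exists_pos_forall_Fop_subset a c
  obtain ⟨D, hD, hx₀D⟩ := exists_mem_FeasEq_of_mem_Fop hx₀
  let β : EuclideanSpace ℝ (Fin n) → Fin m → ℝ := fun x t => b t + ⟪a t, x - x₀⟫
  have hβ : Continuous β := by fun_prop
  have hβ₀ : β x₀ = b := by
    ext t
    simp [β]
  have hev : ∀ᶠ x in nhds x₀, dist (β x) b < δ := by
    have := hβ.continuousAt.preimage_mem_nhds (Metric.ball_mem_nhds (β x₀) hδ)
    rwa [hβ₀] at this
  refine limsup_le_of_le (by isBoundedDefault) ?_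
  filter_upwards [hev] with x hx
  refine ENNReal.div_infEDist_le fun p hp => ?_
  rw [edist_comm]
  by_cases hp1 : dist p.1 c < δ
  · exact (hLip p.2 x (hsub p.1 hp1 p.2 hp)).trans (mul_le_mul_right (le_max_right _ _) _)
  · have hxβ : x ∈ Fop a c (β x) := by
      refine FeasEq_subset_Fop hD.1 ⟨fun t => ?_, fun t ht => ?_⟩
      · have := hx₀D.1 t
        simp only [β, inner_sub_right]
        linarith
      · have := hx₀D.2 t ht
        simp only [β, inner_sub_right]
        linarith
    refine (hLip _ x hxβ).trans (mul_le_mul_right ?_ _)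
    refine le_trans ?_ (le_max_left (edist p.1 c) (edist p.2 b))
    rw [edist_dist, edist_dist]
    exact ENNReal.ofReal_le_ofReal (hx.le.trans (not_lt.1 hp1))

end Moduli

/-- Let `−c̄ ∈ cone{a_t : t ∈ T}`. Then
`Hof F_c̄^op = max_{b ∈ dom F} Lipusc F^op(c̄,b)
= max_{b ∈ dom F} max_{x ∈ E^op(c̄,b)} clm F^op((c̄,b),x)
= max_{D ⊆ S ⊆ T, D ∈ M_c̄} (d_*(0, end conv{a_t, t ∈ S; −a_t, t ∈ D}))⁻¹`,
and all these suprema/maxima are attained. -/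
theorem hof_Fopc_eq {n m : ℕ} (a : Fin m → EuclideanSpace ℝ (Fin n))
    (cbar : EuclideanSpace ℝ (Fin n)) (hc : InCone a Finset.univ (-cbar)) :
    (hofConst (fun b => Fop a cbar b)
      = ⨆ b ∈ {b : Fin m → ℝ | (Feas a b).Nonempty},
          lipuscMod (fun p : EuclideanSpace ℝ (Fin n) × (Fin m → ℝ) => Fop a p.1 p.2)
            (cbar, b)) ∧
    (hofConst (fun b => Fop a cbar b)
      = ⨆ b ∈ {b : Fin m → ℝ | (Feas a b).Nonempty}, ⨆ x ∈ Eop a cbar b,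
          clmMod (fun p : EuclideanSpace ℝ (Fin n) × (Fin m → ℝ) => Fop a p.1 p.2)
            (cbar, b) x) ∧
    (hofConst (fun b => Fop a cbar b)
      = ⨆ D ∈ Mc a cbar, ⨆ S : Finset (Fin m), ⨆ _ : D ⊆ S,
          (EMetric.infEdist (0 : EuclideanSpace ℝ (Fin n))
            (endSet (convexHull ℝ
              ((a '' (S : Set (Fin m))) ∪ ((fun t => -(a t)) '' (D : Set (Fin m)))))))⁻¹) ∧
    (∃ b : Fin m → ℝ, (Feas a b).Nonempty ∧
      hofConst (fun b' => Fop a cbar b')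
        = lipuscMod (fun p : EuclideanSpace ℝ (Fin n) × (Fin m → ℝ) => Fop a p.1 p.2)
            (cbar, b)) ∧
    (∃ b : Fin m → ℝ, (Feas a b).Nonempty ∧ ∃ x ∈ Eop a cbar b,
      hofConst (fun b' => Fop a cbar b')
        = clmMod (fun p : EuclideanSpace ℝ (Fin n) × (Fin m → ℝ) => Fop a p.1 p.2)
            (cbar, b) x) ∧
    (∃ D ∈ Mc a cbar, ∃ S : Finset (Fin m), D ⊆ S ∧
      hofConst (fun b' => Fop a cbar b')
        = (EMetric.infEdist (0 : EuclideanSpace ℝ (Fin n))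
            (endSet (convexHull ℝ
              ((a '' (S : Set (Fin m))) ∪ ((fun t => -(a t)) '' (D : Set (Fin m)))))))⁻¹) := by
  obtain ⟨⟨D, S⟩, ⟨hD, hDS⟩, hmax⟩ := Set.exists_max_image
    {q : Finset (Fin m) × Finset (Fin m) | q.1 ∈ Mc a cbar ∧ q.1 ⊆ q.2}
    (fun q => (Metric.infEDist (0 : EuclideanSpace ℝ (Fin n))
      (endSet (convexHull ℝ (a '' (q.2 : Set (Fin m)) ∪
        (fun t => -(a t)) '' (q.1 : Set (Fin m))))))⁻¹) (Set.toFinite _) (by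
      obtain ⟨D, -, hD⟩ := exists_subset_mem_Mc hc
      exact ⟨(D, D), hD, subset_rfl⟩)
  change D ∈ Mc a cbar at hD
  change D ⊆ S at hDS
  dsimp only at hmax
  have hK : ∀ D' ∈ Mc a cbar, ∀ S', D' ⊆ S' → _ ≤ _ := fun D' hD' S' hS' =>
    hmax (D', S') ⟨hD', hS'⟩
  dsimp only at hK
  set K : ℝ≥0∞ := (Metric.infEDist (0 : EuclideanSpace ℝ (Fin n))
    (endSet (convexHull ℝ (a '' (S : Set (Fin m)) ∪ (fun t => -(a t)) '' (D : Set (Fin m))))))⁻¹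
    with hKdef
  have hLip : ∀ b, (Feas a b).Nonempty → ∀ b', ∀ x ∈ Fop a cbar b',
      Metric.infEDist x (Fop a cbar b) ≤ K * edist b' b :=
    fun b hb b' x hx => infEDist_Fop_le hK hc hb hx
  obtain ⟨b, hb, x₀, hx₀, hpert⟩ := exists_Eop_perturbation hD hDS
  have hne : (Fop a cbar b).Nonempty := ⟨x₀, hx₀.1.1⟩
  have hHof : hofConst (fun b => Fop a cbar b) = K := by
    refine le_antisymm (hofConst_Fop_le hLip) (inv_infEDist_zero_le fun u hu => ?_)
    obtain ⟨ε, hε, -, x, -, b', hb', hx, hgrow⟩ := hpert u hu 1 one_pos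
    refine (inv_enorm_le_infEDist_div hne hε hgrow ?_).trans
      (le_iSup₂_of_le b hne (le_iSup_of_le x le_rfl))
    refine (Metric.infEDist_le_edist_of_mem (y := b') hx).trans ?_
    rw [edist_comm, edist_dist]
    exact ENNReal.ofReal_le_ofReal hb'
  have hLipusc : lipuscMod (fun p : EuclideanSpace ℝ (Fin n) × (Fin m → ℝ) => Fop a p.1 p.2)
      (cbar, b) = K := by
    refine le_antisymm (lipuscMod_Fop_le (hLip b hb)) (inv_infEDist_zero_le fun u hu => ?_)
    refine le_limsup_of_frequently_le ?_ (by isBoundedDefault)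
    refine Metric.nhds_basis_ball.frequently_iff.2 fun δ hδ => ?_
    obtain ⟨ε, hε, hεδ, x, -, b', hb', hx, hgrow⟩ := hpert u hu δ hδ
    have hdist : dist ((cbar, b') : EuclideanSpace ℝ (Fin n) × (Fin m → ℝ)) (cbar, b) ≤ ε := by
      rw [Prod.dist_eq, dist_self]
      exact max_le hε.le hb'
    refine ⟨(cbar, b'), hdist.trans_lt hεδ, ?_⟩
    refine (inv_enorm_le_infEDist_div hne hε hgrow ?_).trans (le_iSup₂_of_le x hx le_rfl)
    rw [edist_dist]
    exact ENNReal.ofReal_le_ofReal hdist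
  have hClm : clmMod (fun p : EuclideanSpace ℝ (Fin n) × (Fin m → ℝ) => Fop a p.1 p.2)
      (cbar, b) x₀ = K := by
    refine le_antisymm (clmMod_Fop_le hx₀.1.1 (hLip b hb)) (inv_infEDist_zero_le fun u hu => ?_)
    refine le_limsup_of_frequently_le ?_ (by isBoundedDefault)
    refine Metric.nhds_basis_ball.frequently_iff.2 fun δ hδ => ?_
    obtain ⟨ε, hε, -, x, hxδ, b', hb', hx, hgrow⟩ := hpert u hu δ hδ
    refine ⟨x, hxδ, inv_enorm_le_infEDist_div hne hε hgrow ?_⟩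
    refine (Metric.infEDist_le_edist_of_mem (y := (cbar, b')) hx).trans ?_
    rw [edist_comm, edist_dist, Prod.dist_eq, dist_self]
    exact ENNReal.ofReal_le_ofReal (max_le hε.le hb')
  rw [hHof]
  refine ⟨le_antisymm ?_ ?_, le_antisymm ?_ ?_, le_antisymm ?_ ?_, ⟨b, hb, hLipusc.symm⟩,
    ⟨b, hb, x₀, hx₀, hClm.symm⟩, ⟨D, hD, S, hDS, rfl⟩⟩
  · exact le_iSup₂_of_le b hb hLipusc.ge
  · exact iSup₂_le fun b hb => lipuscMod_Fop_le (hLip b hb)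
  · exact le_iSup₂_of_le b hb (le_iSup₂_of_le x₀ hx₀ hClm.ge)
  · exact iSup₂_le fun b hb => iSup₂_le fun x hx => clmMod_Fop_le hx.1.1 (hLip b hb)
  · exact le_iSup₂_of_le D hD (le_iSup₂_of_le S hDS le_rfl)
  · exact iSup₂_le fun D' hD' => iSup₂_le fun S' hS' => hK D' hD' S' hS'
end

section
/- Let b̄, b ∈ dom F with b̄ ≠ b. Then the break step set B(b̄,b) is a finite (possibly empty) subset of (0,1). -/
open scoped ENNReal RealInnerProductSpace
open Filter EMetric Set

/-- The break step set `B(b̄,b)`: points `μ ∈ (0,1)` approachable by a sequence `ν_r → μ`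
with `M_{c,b̄+ν_r(b−b̄)} ⊊ M_{c,b̄+μ(b−b̄)}` for all `r`. -/
def BreakSet {n m : ℕ} (a : Fin m → EuclideanSpace ℝ (Fin n)) (c : EuclideanSpace ℝ (Fin n))
    (bbar b : Fin m → ℝ) : Set ℝ :=
  {μ ∈ Set.Ioo (0 : ℝ) 1 | ∃ ν : ℕ → ℝ, Tendsto ν atTop (nhds μ) ∧
    ∀ r : ℕ, Mcb a c (bbar + ν r • (b - bbar)) ⊂ Mcb a c (bbar + μ • (b - bbar))}

/-- A KKT certificate: a feasible point whose active constraints generate `-c` is optimal. -/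
theorem mem_Fop_of_inCone {n m : ℕ} {a : Fin m → EuclideanSpace ℝ (Fin n)}
    {c : EuclideanSpace ℝ (Fin n)} {b : Fin m → ℝ} {x : EuclideanSpace ℝ (Fin n)}
    {D : Finset (Fin m)} (hx : x ∈ Feas a b) (hact : (D : Set (Fin m)) ⊆ activeSet a b x)
    (hD : InCone a D (-c)) : x ∈ Fop a c b := by
  refine ⟨hx, fun y hy => ?_⟩
  obtain ⟨lam, hlam, hzero, hc⟩ := hD
  have key : ∀ z : EuclideanSpace ℝ (Fin n), -⟪c, z⟫ = ∑ t, lam t * ⟪a t, z⟫ := fun z => by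
    rw [← inner_neg_left, hc, sum_inner]
    exact Finset.sum_congr rfl fun t _ => real_inner_smul_left _ _ _
  have hle : ∑ t, lam t * ⟪a t, y⟫ ≤ ∑ t, lam t * ⟪a t, x⟫ := by
    refine Finset.sum_le_sum fun t _ => ?_
    by_cases ht : t ∈ D
    · have hxt : ⟪a t, x⟫ = b t := hact ht
      rw [hxt]
      exact mul_le_mul_of_nonneg_left (hy t) (hlam t)
    · simp [hzero t ht]
  linarith [key x, key y]

/-- Along a line of right-hand sides, the parameters at which a given index set is a minimal
KKT set form a convex set. -/
theorem convex_setOf_mem_Mcb {n m : ℕ} (a : Fin m → EuclideanSpace ℝ (Fin n))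
    (c : EuclideanSpace ℝ (Fin n)) (b d : Fin m → ℝ) (D : Finset (Fin m)) :
    Convex ℝ {μ : ℝ | D ∈ Mcb a c (b + μ • d)} := by
  rintro μ ⟨x, hx, hxD, hD, hmin⟩ ν ⟨y, hy, hyD, -, -⟩ α β hα hβ hαβ
  have hb : ∀ t, (b + (α • μ + β • ν) • d) t =
      α * (b + μ • d) t + β * (b + ν • d) t := fun t => by
    simp only [Pi.add_apply, Pi.smul_apply, smul_eq_mul]
    linear_combination -(b t) * hαβ
  have hinner : ∀ t, ⟪a t, α • x + β • y⟫ = α * ⟪a t, x⟫ + β * ⟪a t, y⟫ := fun t => by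
    rw [inner_add_right, real_inner_smul_right, real_inner_smul_right]
  have hact : (D : Set (Fin m)) ⊆
      activeSet a (b + (α • μ + β • ν) • d) (α • x + β • y) := fun t ht => by
    have h₁ : ⟪a t, x⟫ = (b + μ • d) t := hxD ht
    have h₂ : ⟪a t, y⟫ = (b + ν • d) t := hyD ht
    change ⟪a t, α • x + β • y⟫ = _
    rw [hinner, hb, h₁, h₂]
  refine ⟨α • x + β • y, mem_Fop_of_inCone (fun t => ?_) hact hD, hact, hD, hmin⟩
  rw [hinner, hb]
  exact add_le_add (mul_le_mul_of_nonneg_left (hx.1 t) hα)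
    (mul_le_mul_of_nonneg_left (hy.1 t) hβ)

/-- An order-connected set of reals has only finitely many points outside its interior. -/
theorem Set.OrdConnected.finite_diff_interior {s : Set ℝ} (hs : s.OrdConnected) :
    (s \ interior s).Finite := by
  by_contra hinf
  obtain ⟨t, hts, ht⟩ := Set.Infinite.exists_subset_card_eq hinf 3
  let f := t.orderEmbOfFin ht
  have hf : ∀ i, f i ∈ s \ interior s := fun i => hts (t.orderEmbOfFin_mem ht i)
  have h₀₁ : f 0 < f 1 := f.strictMono (by decide)
  have h₁₂ : f 1 < f 2 := f.strictMono (by decide)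
  exact (hf 1).2 (mem_interior_iff_mem_nhds.2 (mem_of_superset (Icc_mem_nhds h₀₁ h₁₂)
    (hs.out (hf 0).1 (hf 2).1)))

/-- Let `b̄, b ∈ dom F` with `b̄ ≠ b`. Then the break step set `B(b̄,b)`
is a finite (possibly empty) subset of `(0,1)`. -/
theorem breakSet_finite {n m : ℕ} (a : Fin m → EuclideanSpace ℝ (Fin n))
    (cbar : EuclideanSpace ℝ (Fin n)) (bbar b : Fin m → ℝ)
    (hbbar : (Feas a bbar).Nonempty) (hb : (Feas a b).Nonempty) (hne : bbar ≠ b) :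
    (BreakSet a cbar bbar b).Finite ∧ BreakSet a cbar bbar b ⊆ Set.Ioo (0 : ℝ) 1 := by
  refine ⟨?_, fun μ hμ => hμ.1⟩
  refine (Set.finite_iUnion fun D : Finset (Fin m) =>
    (convex_setOf_mem_Mcb a cbar bbar (b - bbar) D).ordConnected.finite_diff_interior).subset ?_
  rintro μ ⟨-, ν, hν, hsub⟩
  by_contra hμ
  have hint : ∀ D : Finset (Fin m), ∀ᶠ r in atTop, D ∈ Mcb a cbar (bbar + μ • (b - bbar)) →
      D ∈ Mcb a cbar (bbar + ν r • (b - bbar)) := fun D => by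
    by_cases hD : D ∈ Mcb a cbar (bbar + μ • (b - bbar))
    · have hD' : μ ∈ interior {μ : ℝ | D ∈ Mcb a cbar (bbar + μ • (b - bbar))} := by
        by_contra h
        exact hμ (Set.mem_iUnion.2 ⟨D, hD, h⟩)
      filter_upwards [hν (mem_interior_iff_mem_nhds.1 hD')] with r hr _ using hr
    · exact Eventually.of_forall fun r h => absurd h hD
  obtain ⟨r, hr⟩ := (eventually_all.2 hint).exists
  exact (hsub r).2 fun D => hr D
end
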